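/- Let d = 2. For every z ∈ ℂ ∖ [0,8] and every (m,l) ∈ ℕ₀² one has 𝒬(m,l) = −(1/4)·₄F₃(1+m, −m, 1+l, −l; 1, 1/2, 1/2; (z−4)²/16) + ((z−4)/4)·(2m+1)(2l+1)·𝒫₀(0)·₄F₃(1+m, −m, 1+l, −l; 1, 3/2, 3/2; (z−4)²/16) − ((z−4)/4)·(2l+1)·Σ_{μ=−m}^{m} 𝒫₀(μ)·₄F₃(1+m−|μ|, |μ|−m, 1+l, −l; 1, 1/2, 3/2; (z−4)²/16) − ((z−4)/4)·(2m+1)·Σ_{ν=−l}^{l} 𝒫₀(ν)·₄F₃(1+m, −m, 1+l−|ν|, |ν|−l; 1, 1/2, 3/2; (z−4)²/16). -/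

import Mathlib

open MeasureTheory

/-- The lattice resolvent kernel `G(z,n)` in dimension `d`. -/
noncomputable def G (d : ℕ) (z : ℂ) (n : Fin d → ℤ) : ℂ :=
  (2 * (Real.pi : ℂ)) ^ (-(d : ℤ)) *
    ∫ θ : Fin d → ℝ in Set.univ.pi fun _ => Set.Icc (-Real.pi) Real.pi,
      Complex.exp (Complex.I * ∑ j, (n j : ℂ) * (θ j : ℂ)) /
        (2 * d - 2 * ∑ j, (Real.cos (θ j) : ℂ) - z)

/-- The Pochhammer symbol `(q)_k = q (q+1) ⋯ (q+k-1)` on `ℂ`. -/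
noncomputable def poch (q : ℂ) (k : ℕ) : ℂ := ∏ j ∈ Finset.range k, (q + j)

/-- The generalized hypergeometric series `₄F₃(a₁,a₂,a₃,a₄; b₁,b₂,b₃; x)`. -/
noncomputable def F43 (a₁ a₂ a₃ a₄ b₁ b₂ b₃ x : ℂ) : ℂ :=
  ∑' k : ℕ, poch a₁ k * poch a₂ k * poch a₃ k * poch a₄ k /
    (poch b₁ k * poch b₂ k * poch b₃ k * (k.factorial : ℂ)) * x ^ k

/-- `𝒬(m,l) = (-1)^{m+l} G(z, m+l+1, m-l)`. -/
noncomputable def Q (z : ℂ) (m l : ℤ) : ℂ := (-1 : ℂ) ^ (m + l) * G 2 z ![m + l + 1, m - l]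

/-- `𝒫₀(m) = (-1)^m G(z, m, m)`. -/
noncomputable def P₀ (z : ℂ) (m : ℤ) : ℂ := (-1 : ℂ) ^ m * G 2 z ![m, m]

theorem poch_succ (q : ℂ) (k : ℕ) : poch q (k + 1) = poch q k * (q + k) :=
  Finset.prod_range_succ _ _

theorem poch_one (k : ℕ) : poch 1 k = k.factorial := by
  induction k with
  | zero => simp [poch]
  | succ k ih =>
    rw [poch_succ, ih, Nat.factorial_succ]
    push_cast
    ring

theorem poch_half (k : ℕ) : poch (1 / 2) k * k.factorial * 4 ^ k = (2 * k).factorial := by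
  induction k with
  | zero => simp [poch]
  | succ k ih =>
    rw [poch_succ, Nat.factorial_succ, show 2 * (k + 1) = 2 * k + 1 + 1 by ring,
      Nat.factorial_succ, Nat.factorial_succ]
    push_cast
    rw [← ih]
    ring

theorem poch_three_halves (k : ℕ) : poch (3 / 2) k = (2 * k + 1) * poch (1 / 2) k := by
  induction k with
  | zero => simp [poch]
  | succ k ih =>
    rw [poch_succ, poch_succ, ih]
    push_cast
    ring

theorem poch_mul_poch_neg (m k : ℕ) :
    poch (1 + m) k * poch (-m) k = (-1) ^ k * (2 * k).factorial * (m + k).choose (2 * k) := by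
  induction k with
  | zero => simp [poch]
  | succ k ih =>
    have key : ((m + k + 1).choose (2 * k + 1 + 1) : ℂ) * (2 * k + 1 + 1) * (2 * k + 1) =
        (m + k + 1) * (m - k) * (m + k).choose (2 * k) := by
      rcases lt_or_ge m k with h | h
      · rw [Nat.choose_eq_zero_of_lt (by omega), Nat.choose_eq_zero_of_lt (by omega)]
        simp
      · have h1 : ((m + k + 1 : ℕ) * (m + k).choose (2 * k + 1) : ℂ) =
            (m + k + 1).choose (2 * k + 1 + 1) * (2 * k + 1 + 1 : ℕ) := by
          exact_mod_cast Nat.add_one_mul_choose_eq (m + k) (2 * k + 1)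
        have h2 : ((m + k).choose (2 * k + 1) * (2 * k + 1 : ℕ) : ℂ) =
            (m + k).choose (2 * k) * (m + k - 2 * k : ℕ) := by
          exact_mod_cast Nat.choose_succ_right_eq (m + k) (2 * k)
        rw [show m + k - 2 * k = m - k by omega, Nat.cast_sub h] at h2
        push_cast at h1 h2
        linear_combination (-(2 * k + 1) : ℂ) * h1 + (m + k + 1) * h2
    rw [poch_succ, poch_succ, show 2 * (k + 1) = 2 * k + 1 + 1 by ring, Nat.factorial_succ,
      Nat.factorial_succ, ← add_assoc]
    push_cast
    linear_combination (-((m + k + 1) * (m - k)) : ℂ) * ih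
      + (-1) ^ k * (2 * k).factorial * key

theorem F43_eq_sum {p q N : ℕ} (hN : p < N ∨ q < N) (b c x : ℂ) :
    F43 (1 + p) (-p) (1 + q) (-q) 1 b c x =
      ∑ k ∈ Finset.range N, ((p + k).choose (2 * k) * (q + k).choose (2 * k) : ℂ) *
        (((2 * k).factorial / (poch b k * k.factorial)) *
          ((2 * k).factorial / (poch c k * k.factorial))) * x ^ k := by
  have h : ∀ k : ℕ, poch (1 + p) k * poch (-p) k * poch (1 + q) k * poch (-q) k /
      (poch 1 k * poch b k * poch c k * k.factorial) * x ^ k =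
      ((p + k).choose (2 * k) * (q + k).choose (2 * k) : ℂ) *
        (((2 * k).factorial / (poch b k * k.factorial)) *
          ((2 * k).factorial / (poch c k * k.factorial))) * x ^ k := by
    intro k
    rw [mul_assoc (poch _ k * poch _ k), poch_mul_poch_neg, poch_mul_poch_neg, poch_one,
      div_mul_div_comm, mul_div_assoc']
    congr 1
    have : ((-1 : ℂ) ^ k) * (-1) ^ k = 1 := by rw [← mul_pow]; simp
    congr 1
    · linear_combination ((2 * k).factorial * (p + k).choose (2 * k) * (2 * k).factorial *
        (q + k).choose (2 * k) : ℂ) * this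
    · ring
  rw [F43, tsum_congr h]
  refine tsum_eq_sum fun k hk => ?_
  rw [Finset.mem_range, not_lt] at hk
  rcases hN with hN | hN
  · rw [Nat.choose_eq_zero_of_lt (show p + k < 2 * k by omega)]
    simp
  · rw [Nat.choose_eq_zero_of_lt (show q + k < 2 * k by omega)]
    simp

theorem factorial_div_poch_half (k : ℕ) :
    ((2 * k).factorial / (poch (1 / 2) k * k.factorial) : ℂ) = 4 ^ k := by
  have h : ((2 * k).factorial : ℂ) ≠ 0 := by exact_mod_cast Nat.factorial_ne_zero _
  rw [← poch_half] at h ⊢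
  rw [mul_div_cancel_left₀ _ (left_ne_zero_of_mul h)]

theorem factorial_div_poch_three_halves (k : ℕ) :
    ((2 * k).factorial / (poch (3 / 2) k * k.factorial) : ℂ) = 4 ^ k / (2 * k + 1) := by
  rw [← factorial_div_poch_half, poch_three_halves, div_div]
  congr 1
  ring

/-- The integrand of the planar resolvent kernel. -/
noncomputable def kern (z : ℂ) (a b : ℤ) (x y : ℝ) : ℂ :=
  Complex.exp (Complex.I * (a * x + b * y)) / (4 - 2 * (Real.cos x + Real.cos y : ℝ) - z)

theorem denom_ne_zero {z : ℂ} (hz : ∀ x : ℝ, 0 ≤ x → x ≤ 8 → z ≠ (x : ℂ)) (x y : ℝ) :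
    (4 - 2 * (Real.cos x + Real.cos y : ℝ) - z : ℂ) ≠ 0 := by
  intro h
  refine hz (4 - 2 * (Real.cos x + Real.cos y)) ?_ ?_ ?_
  · linarith [Real.cos_le_one x, Real.cos_le_one y]
  · linarith [Real.neg_one_le_cos x, Real.neg_one_le_cos y]
  · push_cast at h ⊢
    linear_combination -h

theorem continuous_kern {z : ℂ} (hz : ∀ x : ℝ, 0 ≤ x → x ≤ 8 → z ≠ (x : ℂ)) (a b : ℤ) :
    Continuous (Function.uncurry (kern z a b)) := by
  unfold kern Function.uncurry
  exact Continuous.div (by fun_prop) (by fun_prop) fun p => denom_ne_zero hz _ _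

theorem G_eq_intervalIntegral {z : ℂ} (hz : ∀ x : ℝ, 0 ≤ x → x ≤ 8 → z ≠ (x : ℂ)) (a b : ℤ) :
    G 2 z ![a, b] = (2 * (Real.pi : ℂ)) ^ (-2 : ℤ) *
      ∫ x in -Real.pi..Real.pi, ∫ y in -Real.pi..Real.pi, kern z a b x y := by
  have hpi : -Real.pi ≤ Real.pi := by linarith [Real.pi_pos]
  have hset : (Set.univ.pi fun _ : Fin 2 => Set.Icc (-Real.pi) Real.pi) =
      MeasurableEquiv.finTwoArrow ⁻¹'
        (Set.Icc (-Real.pi) Real.pi ×ˢ Set.Icc (-Real.pi) Real.pi) := by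
    ext θ
    simp only [Set.mem_univ_pi, Set.mem_preimage, Set.mem_prod, Fin.forall_fin_two]
    rfl
  have hint : IntegrableOn (Function.uncurry (kern z a b))
      (Set.Icc (-Real.pi) Real.pi ×ˢ Set.Icc (-Real.pi) Real.pi) (volume.prod volume) :=
    (continuous_kern hz a b).continuousOn.integrableOn_compact (isCompact_Icc.prod isCompact_Icc)
  have h := (volume_preserving_finTwoArrow ℝ).setIntegral_preimage_emb
    MeasurableEquiv.finTwoArrow.measurableEmbedding (Function.uncurry (kern z a b))
    (Set.Icc (-Real.pi) Real.pi ×ˢ Set.Icc (-Real.pi) Real.pi)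
  rw [← hset, Measure.volume_eq_prod, setIntegral_prod _ hint] at h
  simp only [intervalIntegral.integral_of_le hpi, ← integral_Icc_eq_integral_Ioc]
  rw [G]
  refine congrArg₂ _ (by norm_num) ?_
  refine Eq.trans ?_ h
  congr 1
  ext θ
  simp only [kern, Function.uncurry, MeasurableEquiv.finTwoArrow_apply, Fin.sum_univ_two,
    Matrix.cons_val_zero, Matrix.cons_val_one]
  push_cast
  norm_num

theorem G_swap {z : ℂ} (hz : ∀ x : ℝ, 0 ≤ x → x ≤ 8 → z ≠ (x : ℂ)) (a b : ℤ) :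
    G 2 z ![a, b] = G 2 z ![b, a] := by
  rw [G_eq_intervalIntegral hz, G_eq_intervalIntegral hz,
    intervalIntegral_intervalIntegral_swap]
  · have : ∀ x y, kern z a b x y = kern z b a y x := by
      intro x y
      rw [kern, kern, add_comm (Real.cos x), add_comm ((a : ℂ) * x)]
    simp only [this]
  · exact ((continuous_kern hz a b).continuousOn.integrableOn_compact
      (isCompact_uIcc.prod isCompact_uIcc)).mono_set
      (Set.prod_mono Set.uIoc_subset_uIcc Set.uIoc_subset_uIcc)

theorem G_neg_right {z : ℂ} (hz : ∀ x : ℝ, 0 ≤ x → x ≤ 8 → z ≠ (x : ℂ)) (a b : ℤ) :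
    G 2 z ![a, -b] = G 2 z ![a, b] := by
  rw [G_eq_intervalIntegral hz, G_eq_intervalIntegral hz]
  congr 2
  ext x
  have := intervalIntegral.integral_comp_neg (a := -Real.pi) (b := Real.pi) (kern z a b x)
  rw [neg_neg] at this
  rw [← this]
  congr 1
  ext y
  simp [kern]

theorem G_neg_left {z : ℂ} (hz : ∀ x : ℝ, 0 ≤ x → x ≤ 8 → z ≠ (x : ℂ)) (a b : ℤ) :
    G 2 z ![-a, b] = G 2 z ![a, b] := by
  rw [G_swap hz, G_neg_right hz, G_swap hz]

theorem integral_exp_int (a : ℤ) :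
    ∫ x in -Real.pi..Real.pi, Complex.exp (Complex.I * (a * x)) =
      if a = 0 then 2 * (Real.pi : ℂ) else 0 := by
  split_ifs with h
  · subst h
    simp
    ring
  · have ha : Complex.I * a ≠ 0 := mul_ne_zero Complex.I_ne_zero (by exact_mod_cast h)
    simp only [← mul_assoc]
    rw [integral_exp_mul_complex ha]
    have : Complex.exp (Complex.I * a * (Real.pi : ℝ)) =
        Complex.exp (Complex.I * a * (-Real.pi : ℝ)) :=
      Complex.exp_eq_exp_iff_exists_int.2 ⟨a, by push_cast; ring⟩
    rw [this, sub_self, zero_div]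

/-- The resolvent equation on the square lattice. -/
theorem G_resolvent {z : ℂ} (hz : ∀ x : ℝ, 0 ≤ x → x ≤ 8 → z ≠ (x : ℂ)) (a b : ℤ) :
    (4 - z) * G 2 z ![a, b] - G 2 z ![a + 1, b] - G 2 z ![a - 1, b] - G 2 z ![a, b + 1]
      - G 2 z ![a, b - 1] = if a = 0 ∧ b = 0 then 1 else 0 := by
  have hpt : ∀ x y, (4 - z) * kern z a b x y - kern z (a + 1) b x y - kern z (a - 1) b x y
      - kern z a (b + 1) x y - kern z a (b - 1) x y =
      Complex.exp (Complex.I * (a * x)) * Complex.exp (Complex.I * (b * y)) := by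
    intro x y
    have hd := denom_ne_zero hz x y
    simp only [kern]
    rw [← mul_div_assoc, ← sub_div, ← sub_div, ← sub_div, ← sub_div, div_eq_iff hd]
    have h1 : Complex.exp (Complex.I * ((a + 1 : ℤ) * x + b * y)) =
        Complex.exp (Complex.I * (a * x + b * y)) * Complex.exp (x * Complex.I) := by
      rw [← Complex.exp_add]
      push_cast
      ring_nf
    have h2 : Complex.exp (Complex.I * ((a - 1 : ℤ) * x + b * y)) =
        Complex.exp (Complex.I * (a * x + b * y)) * Complex.exp (-x * Complex.I) := by
      rw [← Complex.exp_add]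
      push_cast
      ring_nf
    have h3 : Complex.exp (Complex.I * (a * x + (b + 1 : ℤ) * y)) =
        Complex.exp (Complex.I * (a * x + b * y)) * Complex.exp (y * Complex.I) := by
      rw [← Complex.exp_add]
      push_cast
      ring_nf
    have h4 : Complex.exp (Complex.I * (a * x + (b - 1 : ℤ) * y)) =
        Complex.exp (Complex.I * (a * x + b * y)) * Complex.exp (-y * Complex.I) := by
      rw [← Complex.exp_add]
      push_cast
      ring_nf
    have h0 : Complex.exp (Complex.I * (a * x + b * y)) =
        Complex.exp (Complex.I * (a * x)) * Complex.exp (Complex.I * (b * y)) := by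
      rw [← Complex.exp_add, mul_add]
    rw [h1, h2, h3, h4, h0]
    push_cast
    rw [Complex.cos, Complex.cos]
    ring
  have hi : ∀ (a b : ℤ) (x : ℝ), IntervalIntegrable (kern z a b x) volume (-Real.pi) Real.pi :=
    fun a b x => ((continuous_kern hz a b).comp (Continuous.prodMk_right x)).intervalIntegrable _ _
  have ho : ∀ a b : ℤ, IntervalIntegrable
      (fun x => ∫ y in -Real.pi..Real.pi, kern z a b x y) volume (-Real.pi) Real.pi := fun a b =>
    (intervalIntegral.continuous_parametric_intervalIntegral_of_continuous'
      (continuous_kern hz a b) _ _).intervalIntegrable _ _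
  have h : ∫ x in -Real.pi..Real.pi, ∫ y in -Real.pi..Real.pi,
      ((4 - z) * kern z a b x y - kern z (a + 1) b x y - kern z (a - 1) b x y
      - kern z a (b + 1) x y - kern z a (b - 1) x y) =
      (if a = 0 then 2 * (Real.pi : ℂ) else 0) * (if b = 0 then 2 * (Real.pi : ℂ) else 0) := by
    simp only [hpt, intervalIntegral.integral_const_mul, intervalIntegral.integral_mul_const,
      integral_exp_int]
  have hs : ∀ x, ∫ y in -Real.pi..Real.pi,
      ((4 - z) * kern z a b x y - kern z (a + 1) b x y - kern z (a - 1) b x y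
      - kern z a (b + 1) x y - kern z a (b - 1) x y) =
      (4 - z) * (∫ y in -Real.pi..Real.pi, kern z a b x y)
      - (∫ y in -Real.pi..Real.pi, kern z (a + 1) b x y)
      - (∫ y in -Real.pi..Real.pi, kern z (a - 1) b x y)
      - (∫ y in -Real.pi..Real.pi, kern z a (b + 1) x y)
      - ∫ y in -Real.pi..Real.pi, kern z a (b - 1) x y := by
    intro x
    have i₁ := (hi a b x).const_mul (4 - z)
    have i₂ := i₁.sub (hi (a + 1) b x)
    have i₃ := i₂.sub (hi (a - 1) b x)
    have i₄ := i₃.sub (hi a (b + 1) x)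
    rw [intervalIntegral.integral_sub i₄ (hi a (b - 1) x),
      intervalIntegral.integral_sub i₃ (hi a (b + 1) x),
      intervalIntegral.integral_sub i₂ (hi (a - 1) b x),
      intervalIntegral.integral_sub i₁ (hi (a + 1) b x), intervalIntegral.integral_const_mul]
  simp only [hs] at h
  have i₁ := (ho a b).const_mul (4 - z)
  have i₂ := i₁.sub (ho (a + 1) b)
  have i₃ := i₂.sub (ho (a - 1) b)
  have i₄ := i₃.sub (ho a (b + 1))
  rw [intervalIntegral.integral_sub i₄ (ho a (b - 1)),
    intervalIntegral.integral_sub i₃ (ho a (b + 1)),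
    intervalIntegral.integral_sub i₂ (ho (a - 1) b),
    intervalIntegral.integral_sub i₁ (ho (a + 1) b), intervalIntegral.integral_const_mul] at h
  have hpi : (2 * (Real.pi : ℂ)) ≠ 0 := by simp [Real.pi_ne_zero]
  have hR : (2 * (Real.pi : ℂ)) ^ (-2 : ℤ) * ((if a = 0 then 2 * (Real.pi : ℂ) else 0) *
      (if b = 0 then 2 * (Real.pi : ℂ) else 0)) = if a = 0 ∧ b = 0 then 1 else 0 := by
    rw [zpow_neg]
    by_cases ha : a = 0 <;> by_cases hb : b = 0 <;> simp [ha, hb]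
    field_simp
  simp only [G_eq_intervalIntegral hz]
  rw [← hR, ← h]
  ring

/-- `𝒫(m,l) = (-1)^{m+l} G(z, m+l, m-l)`. -/
noncomputable def P (z : ℂ) (m l : ℤ) : ℂ := (-1 : ℂ) ^ (m + l) * G 2 z ![m + l, m - l]

theorem P_zero_right (z : ℂ) (m : ℤ) : P z m 0 = P₀ z m := by simp [P, P₀]

theorem P_swap {z : ℂ} (hz : ∀ x : ℝ, 0 ≤ x → x ≤ 8 → z ≠ (x : ℂ)) (m l : ℤ) :
    P z m l = P z l m := by
  rw [P, P, add_comm l m, ← G_neg_right hz, neg_sub]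

theorem P_neg_right {z : ℂ} (hz : ∀ x : ℝ, 0 ≤ x → x ≤ 8 → z ≠ (x : ℂ)) (m l : ℤ) :
    P z m (-l) = P z m l := by
  rw [P, P, G_swap hz, ← sub_eq_add_neg, sub_neg_eq_add, show m + l = m - l + 2 * l by ring,
    zpow_add₀ (by simp), zpow_mul]
  simp

theorem Q_swap {z : ℂ} (hz : ∀ x : ℝ, 0 ≤ x → x ≤ 8 → z ≠ (x : ℂ)) (m l : ℤ) :
    Q z m l = Q z l m := by
  rw [Q, Q, add_comm l m, ← G_neg_right hz, neg_sub]

theorem Q_reflect_right {z : ℂ} (hz : ∀ x : ℝ, 0 ≤ x → x ≤ 8 → z ≠ (x : ℂ)) (m l : ℤ) :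
    Q z m (-1 - l) = -Q z m l := by
  rw [Q, Q, G_swap hz, show m - (-1 - l) = m + l + 1 by ring, show m + (-1 - l) + 1 = m - l by ring,
    show m + (-1 - l) = m + l + 2 * (-l) + (-1) by ring,
    zpow_add₀ (by simp), zpow_add₀ (by simp), zpow_mul]
  simp

theorem Q_diff {z : ℂ} (hz : ∀ x : ℝ, 0 ≤ x → x ≤ 8 → z ≠ (x : ℂ)) (m l : ℤ) :
    Q z m l - Q z (m - 1) l - Q z m (l - 1) + Q z (m - 1) (l - 1) =
      -4 * ((z - 4) / 4) * P z m l - if m = 0 ∧ l = 0 then 1 else 0 := by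
  have h := G_resolvent hz (m + l) (m - l)
  have h0 : (if m + l = 0 ∧ m - l = 0 then (1 : ℂ) else 0) = if m = 0 ∧ l = 0 then 1 else 0 :=
    if_congr (by omega) rfl rfl
  have hs : (-1 : ℂ) ^ (m + l) * (if m = 0 ∧ l = 0 then (1 : ℂ) else 0) =
      if m = 0 ∧ l = 0 then 1 else 0 := by
    split_ifs with h
    · simp [h]
    · simp
  have e : ∀ n : ℤ, (-1 : ℂ) ^ (n - 1) = -(-1) ^ n := fun n => by
    rw [zpow_sub₀ (by simp), zpow_one, div_neg, div_one]
  rw [h0] at h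
  rw [← hs, ← h, Q, Q, Q, Q, P, show m - 1 + l + 1 = m + l by ring,
    show m + (l - 1) + 1 = m + l by ring, show m - 1 + (l - 1) + 1 = m + l - 1 by ring,
    show m - 1 + l = m + l - 1 by ring, show m + (l - 1) = m + l - 1 by ring,
    show m - 1 + (l - 1) = m + l - 1 - 1 by ring, show m - 1 - l = m - l - 1 by ring,
    show m - (l - 1) = m - l + 1 by ring, show m - 1 - (l - 1) = m - l by ring]
  simp only [e]
  ring

theorem P_diff {z : ℂ} (hz : ∀ x : ℝ, 0 ≤ x → x ≤ 8 → z ≠ (x : ℂ)) (m l : ℤ) :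
    P z (m + 1) (l + 1) - P z (m + 1) l - P z m (l + 1) + P z m l =
      -4 * ((z - 4) / 4) * Q z m l := by
  have h := G_resolvent hz (m + l + 1) (m - l)
  rw [if_neg (by omega)] at h
  have e : ∀ n : ℤ, (-1 : ℂ) ^ (n + 1) = -(-1) ^ n := fun n => by
    rw [zpow_add₀ (by simp)]
    simp
  rw [P, P, P, P, Q, show m + 1 + (l + 1) = m + l + 1 + 1 by ring,
    show m + 1 + l = m + l + 1 by ring, show m + (l + 1) = m + l + 1 by ring,
    show m + 1 - (l + 1) = m - l by ring, show m + 1 - l = m - l + 1 by ring,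
    show m - (l + 1) = m - l - 1 by ring, e, e]
  rw [add_sub_cancel_right] at h
  linear_combination -(-1 : ℂ) ^ (m + l) * h

section

open Finset

/-- Discrete convolution with `n ↦ n`, that is, summing twice. -/
noncomputable def doubleSum (f : ℕ → ℂ) (m : ℕ) : ℂ :=
  ∑ p ∈ antidiagonal m, (p.1 : ℂ) * f p.2

theorem doubleSum_zero (f : ℕ → ℂ) : doubleSum f 0 = 0 := by simp [doubleSum]

theorem doubleSum_succ (f : ℕ → ℂ) (m : ℕ) :
    doubleSum f (m + 1) = doubleSum f m + ∑ i ∈ range (m + 1), f i := by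
  rw [doubleSum, Nat.sum_antidiagonal_succ, doubleSum,
    ← Nat.sum_antidiagonal_eq_sum_range_succ_mk (fun p : ℕ × ℕ => f p.1)]
  rw [← Finset.Nat.sum_antidiagonal_swap (f := fun p : ℕ × ℕ => f p.1), ← sum_add_distrib]
  simp only [Prod.fst_swap, Nat.cast_zero, zero_mul, zero_add]
  refine sum_congr rfl fun p _ => ?_
  push_cast
  ring

theorem doubleSum_congr {f g : ℕ → ℂ} {m : ℕ} (h : ∀ i < m, f i = g i) :
    doubleSum f m = doubleSum g m := by
  refine sum_congr rfl fun p hp => ?_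
  rw [HasAntidiagonal.mem_antidiagonal] at hp
  rcases Nat.eq_zero_or_pos p.1 with h0 | h0
  · simp [h0]
  · rw [h _ (by omega)]

theorem doubleSum_mul_left (c : ℂ) (f : ℕ → ℂ) (m : ℕ) :
    doubleSum (fun i => c * f i) m = c * doubleSum f m := by
  rw [doubleSum, doubleSum, mul_sum]
  exact sum_congr rfl fun p _ => by ring

theorem doubleSum_add (f g : ℕ → ℂ) (m : ℕ) :
    doubleSum (fun i => f i + g i) m = doubleSum f m + doubleSum g m := by
  simp only [doubleSum, mul_add, sum_add_distrib]

theorem doubleSum_sum {ι : Type*} (s : Finset ι) (f : ι → ℕ → ℂ) (m : ℕ) :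
    doubleSum (fun i => ∑ k ∈ s, f k i) m = ∑ k ∈ s, doubleSum (f k) m := by
  simp only [doubleSum, mul_sum]
  exact sum_comm

/-- `doubleSum` commutes with convolutions. -/
theorem doubleSum_conv (c f : ℕ → ℂ) (m : ℕ) :
    doubleSum (fun n => ∑ p ∈ antidiagonal n, c p.1 * f p.2) m =
      ∑ p ∈ antidiagonal m, c p.1 * doubleSum f p.2 := by
  have h := congrArg (PowerSeries.coeff m)
    (mul_left_comm (PowerSeries.mk fun n : ℕ => (n : ℂ)) (PowerSeries.mk c) (PowerSeries.mk f))
  simpa only [doubleSum, PowerSeries.coeff_mul, PowerSeries.coeff_mk] using h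

theorem doubleSum_choose {r p : ℕ} (h : r ≤ p) (m : ℕ) :
    doubleSum (fun i => ((i + r).choose p : ℂ)) m = ((m + r + 1).choose (p + 2) : ℂ) := by
  have h1 : ∀ m, ∑ i ∈ range m, ((i + r).choose p : ℂ) = ((m + r).choose (p + 1) : ℂ) := by
    intro m
    induction m with
    | zero => simp [Nat.choose_eq_zero_of_lt (show r < p + 1 by omega)]
    | succ m ih =>
      rw [sum_range_succ, ih, show m + 1 + r = (m + r) + 1 by ring, Nat.choose_succ_succ]
      push_cast
      ring
  induction m with
  | zero => simp [doubleSum_zero, Nat.choose_eq_zero_of_lt (show r + 1 < p + 2 by omega)]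
  | succ m ih =>
    rw [doubleSum_succ, ih, h1, show m + 1 + r + 1 = (m + r + 1) + 1 by ring,
      Nat.choose_succ_succ (m + r + 1), show m + 1 + r = m + r + 1 by ring]
    push_cast
    ring

theorem sum_Icc_neg_succ (f : ℤ → ℂ) (m : ℕ) :
    ∑ i ∈ Icc (-((m + 1 : ℕ) : ℤ)) ((m + 1 : ℕ) : ℤ), f i =
      ∑ i ∈ Icc (-(m : ℤ)) (m : ℤ), f i + f (m + 1) + f (-(m + 1)) := by
  have : Icc (-((m + 1 : ℕ) : ℤ)) ((m + 1 : ℕ) : ℤ) =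
      insert (-(m + 1 : ℤ)) (insert (m + 1 : ℤ) (Icc (-(m : ℤ)) (m : ℤ))) := by
    ext x
    simp only [mem_Icc, mem_insert]
    push_cast
    omega
  rw [this, sum_insert, sum_insert]
  · ring
  · simp
  · simp only [mem_insert, mem_Icc]
    omega

theorem sum_Icc_neg_sub (g : ℤ → ℂ) (hg : ∀ i, g (-1 - i) = -g i) (m : ℕ) :
    ∑ i ∈ Icc (-(m : ℤ)) (m : ℤ), (g i - g (i - 1)) = 2 * g m := by
  induction m with
  | zero =>
    have := hg 0
    simp at this ⊢
    rw [this]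
    ring
  | succ m ih =>
    rw [sum_Icc_neg_succ, ih]
    have h1 := hg m
    have h2 := hg (m + 1)
    rw [show (-1 - (m : ℤ)) = -(m + 1) by ring] at h1
    rw [show (-1 - (m + 1 : ℤ)) = -(m + 1) - 1 by ring] at h2
    rw [h1, h2]
    push_cast
    rw [add_sub_cancel_right]
    ring

theorem sum_Icc_neg_range_natAbs (f : ℕ → ℂ) (m : ℕ) :
    ∑ i ∈ Icc (-(m : ℤ)) (m : ℤ), ∑ j ∈ range i.natAbs, f j = 2 * doubleSum f m := by
  induction m with
  | zero => simp [doubleSum_zero]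
  | succ m ih =>
    rw [sum_Icc_neg_succ, ih, doubleSum_succ, Int.natAbs_neg, show (m + 1 : ℤ).natAbs = m + 1 by omega]
    ring

/-- The even part of `p : ℤ → ℂ`, folded onto `ℕ`. -/
noncomputable def foldEven (p : ℤ → ℂ) : ℕ → ℂ
  | 0 => p 0
  | i + 1 => p (i + 1) + p (-(i + 1))

theorem sum_Icc_neg_eq_antidiagonal (p : ℤ → ℂ) (f : ℕ → ℂ) (m : ℕ) :
    ∑ i ∈ Icc (-(m : ℤ)) (m : ℤ), p i * f (m - i.natAbs) =
      ∑ q ∈ antidiagonal m, foldEven p q.1 * f q.2 := by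
  have key : ∀ (g : ℕ → ℂ) (n : ℕ), ∑ i ∈ Icc (-(n : ℤ)) (n : ℤ), p i * g i.natAbs =
      ∑ i ∈ range (n + 1), foldEven p i * g i := by
    intro g n
    induction n with
    | zero => simp [foldEven]
    | succ n ih =>
      rw [sum_Icc_neg_succ, ih, sum_range_succ _ (n + 1), Int.natAbs_neg,
        show (n + 1 : ℤ).natAbs = n + 1 by omega, foldEven]
      ring
  rw [Nat.sum_antidiagonal_eq_sum_range_succ (fun i j => foldEven p i * f j)]
  exact key (fun i => f (m - i)) m

theorem doubleSum_sum_Icc (p : ℤ → ℂ) (f : ℕ → ℂ) (m : ℕ) :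
    doubleSum (fun n => ∑ i ∈ Icc (-(n : ℤ)) (n : ℤ), p i * f (n - i.natAbs)) m =
      ∑ i ∈ Icc (-(m : ℤ)) (m : ℤ), p i * doubleSum f (m - i.natAbs) := by
  simp only [sum_Icc_neg_eq_antidiagonal, doubleSum_conv]

/-- A pair of lattice functions linked by mixed differences is determined by its diagonal. -/
theorem eq_add_doubleSum {q p : ℤ → ℤ → ℂ} {w : ℂ}
    (hq : ∀ m l, q m l - q (m - 1) l - q m (l - 1) + q (m - 1) (l - 1) =
      -4 * w * p m l - if m = 0 ∧ l = 0 then 1 else 0)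
    (hp : ∀ m l, p (m + 1) (l + 1) - p (m + 1) l - p m (l + 1) + p m l = -4 * w * q m l)
    (hq₁ : ∀ m l, q (-1 - m) l = -q m l) (hq₂ : ∀ m l, q m (-1 - l) = -q m l)
    (hp₁ : ∀ m l, p (-m) l = p m l) (hp₂ : ∀ m l, p m (-l) = p m l)
    (hps : ∀ l, p 0 l = p l 0) (m l : ℕ) :
    q m l = -(1 / 4) + w * p 0 0 * ((2 * m + 1) * (2 * l + 1))
      - w * ((2 * l + 1) * ∑ i ∈ Icc (-(m : ℤ)) (m : ℤ), p i 0)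
      - w * ((2 * m + 1) * ∑ j ∈ Icc (-(l : ℤ)) (l : ℤ), p j 0)
      + 16 * w ^ 2 * doubleSum (fun i => doubleSum (fun j => q i j) l) m := by
  have hpn : ∀ m l : ℕ, p m l = p m 0 + p l 0 - p 0 0
      - 4 * w * ∑ i ∈ range m, ∑ j ∈ range l, q i j := by
    intro m l
    have h : ∑ i ∈ range m, ∑ j ∈ range l, -4 * w * q i j = p m l - p m 0 - p 0 l + p 0 0 := by
      have h1 : ∀ i : ℕ, ∑ j ∈ range l, -4 * w * q i j =
          (p (i + 1 : ℕ) l - p (i + 1 : ℕ) 0) - (p i l - p i 0) := by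
        intro i
        have := sum_range_sub (fun j : ℕ => p (i + 1 : ℕ) j - p i j) l
        rw [show (p (i + 1 : ℕ) l - p (i + 1 : ℕ) 0) - (p i l - p i 0) =
          (p (i + 1 : ℕ) l - p i l) - (p (i + 1 : ℕ) (0 : ℕ) - p i (0 : ℕ)) by push_cast; ring,
          ← this]
        refine sum_congr rfl fun j _ => ?_
        rw [← hp]
        push_cast
        ring
      rw [sum_congr rfl fun i _ => h1 i,
        sum_range_sub (fun i : ℕ => p i l - p i 0) m]
      push_cast
      ring
    simp only [← mul_sum] at h
    rw [hps] at h
    linear_combination -h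
  have hpz : ∀ i j : ℤ, p i j = p i 0 + p j 0 - p 0 0
      - 4 * w * ∑ i ∈ range i.natAbs, ∑ j ∈ range j.natAbs, q i j := by
    have e₁ : ∀ i l : ℤ, p i l = p i.natAbs l := by
      intro i l
      rcases Int.natAbs_eq i with h | h
      · rw [← h]
      · conv_lhs => rw [h, hp₁]
    have e₂ : ∀ i l : ℤ, p i l = p i l.natAbs := by
      intro i l
      rcases Int.natAbs_eq l with h | h
      · rw [← h]
      · conv_lhs => rw [h, hp₂]
    intro i j
    rw [e₁ i j, e₂ _ j, hpn, ← e₁, ← e₁]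
  have h4 : ∑ i ∈ Icc (-(m : ℤ)) (m : ℤ), ∑ j ∈ Icc (-(l : ℤ)) (l : ℤ),
      (q i j - q (i - 1) j - q i (j - 1) + q (i - 1) (j - 1)) = 4 * q m l := by
    have h1 : ∀ i : ℤ, ∑ j ∈ Icc (-(l : ℤ)) (l : ℤ),
        (q i j - q (i - 1) j - q i (j - 1) + q (i - 1) (j - 1)) = 2 * q i l - 2 * q (i - 1) l := by
      intro i
      rw [← mul_sub, ← sum_Icc_neg_sub (fun j => q i j - q (i - 1) j)]
      · exact sum_congr rfl fun j _ => by ring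
      · intro j
        rw [hq₂, hq₂]
        ring
    rw [sum_congr rfl fun i _ => h1 i, sum_Icc_neg_sub (fun i => 2 * q i l)]
    · ring
    · intro i
      rw [hq₁]
      ring
  have hδ : ∑ i ∈ Icc (-(m : ℤ)) (m : ℤ), ∑ j ∈ Icc (-(l : ℤ)) (l : ℤ),
      (if i = 0 ∧ j = 0 then (1 : ℂ) else 0) = 1 := by
    simp only [ite_and]
    rw [sum_eq_single 0]
    · simp
    · intro b _ hb
      simp [hb]
    · simp
  have hK : ∑ i ∈ Icc (-(m : ℤ)) (m : ℤ), ∑ j ∈ Icc (-(l : ℤ)) (l : ℤ),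
      ∑ i ∈ range i.natAbs, ∑ j ∈ range j.natAbs, q i j =
      4 * doubleSum (fun i => doubleSum (fun j => q i j) l) m := by
    have h1 : ∀ i : ℤ, ∑ j ∈ Icc (-(l : ℤ)) (l : ℤ),
        ∑ i ∈ range i.natAbs, ∑ j ∈ range j.natAbs, q i j =
        ∑ i ∈ range i.natAbs, 2 * doubleSum (fun j => q i j) l := by
      intro i
      rw [sum_comm]
      exact sum_congr rfl fun i _ => sum_Icc_neg_range_natAbs _ _
    rw [sum_congr rfl fun i _ => h1 i, sum_Icc_neg_range_natAbs, doubleSum_mul_left]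
    ring
  simp only [hq, sum_sub_distrib, hδ, ← mul_sum] at h4
  have hcard : ∀ n : ℕ, ((Icc (-(n : ℤ)) (n : ℤ)).card : ℂ) = 2 * n + 1 := by
    intro n
    rw [Int.card_Icc, show ((n : ℤ) + 1 - -(n : ℤ)).toNat = 2 * n + 1 by omega]
    push_cast
    ring
  rw [sum_congr rfl fun i _ => sum_congr rfl fun j _ => hpz i j] at h4
  simp only [sum_sub_distrib, sum_add_distrib, sum_const, nsmul_eq_mul, ← mul_sum, hK, hcard] at h4
  linear_combination -(1 / 4) * h4

theorem doubleSum_odd_choose (k m : ℕ) :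
    doubleSum (fun i => (2 * i + 1) / (2 * k + 1) * ((i + k).choose (2 * k) : ℂ)) m =
      (2 * m + 1) / (2 * (k + 1 : ℕ) + 1) * ((m + (k + 1)).choose (2 * (k + 1)) : ℂ) := by
  have h : ∀ i k : ℕ, (2 * i + 1) / (2 * k + 1) * ((i + k).choose (2 * k) : ℂ) =
      ((i + (k + 1)).choose (2 * k + 1) : ℂ) + ((i + k).choose (2 * k + 1) : ℂ) := by
    intro i k
    have hk : (2 * k + 1 : ℂ) ≠ 0 := by exact_mod_cast (show 2 * k + 1 ≠ 0 by omega)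
    have h1 : ((i + k + 1 : ℕ) * (i + k).choose (2 * k) : ℂ) =
        (i + k + 1).choose (2 * k + 1) * (2 * k + 1 : ℕ) := by
      exact_mod_cast Nat.add_one_mul_choose_eq (i + k) (2 * k)
    have h2 : ((i + k + 1).choose (2 * k + 1) : ℂ) =
        (i + k).choose (2 * k) + (i + k).choose (2 * k + 1) := by
      exact_mod_cast Nat.choose_succ_succ (i + k) (2 * k)
    rw [div_mul_eq_mul_div, div_eq_iff hk, ← add_assoc]
    push_cast at h1
    linear_combination 2 * h1 + (2 * k + 1) * h2
  simp only [h]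
  rw [doubleSum_add, doubleSum_choose (by omega), doubleSum_choose (by omega)]
  congr 3

/-- The `k`-th coefficient of the expansion in powers of `16 w²`. -/
noncomputable def coef (P : ℤ → ℂ) (w : ℂ) (k m l : ℕ) : ℂ :=
  -(1 / 4) * ((m + k).choose (2 * k) * (l + k).choose (2 * k))
    + w * P 0 * ((2 * m + 1) / (2 * k + 1) * (m + k).choose (2 * k) *
        ((2 * l + 1) / (2 * k + 1) * (l + k).choose (2 * k)))
    + -w * ((∑ μ ∈ Icc (-(m : ℤ)) (m : ℤ), P μ * (m - μ.natAbs + k).choose (2 * k)) *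
        ((2 * l + 1) / (2 * k + 1) * (l + k).choose (2 * k)))
    + -w * ((2 * m + 1) / (2 * k + 1) * (m + k).choose (2 * k) *
        ∑ ν ∈ Icc (-(l : ℤ)) (l : ℤ), P ν * (l - ν.natAbs + k).choose (2 * k))

theorem doubleSum_doubleSum_mul (f g : ℕ → ℂ) (m l : ℕ) :
    doubleSum (fun i => doubleSum (fun j => f i * g j) l) m = doubleSum f m * doubleSum g l := by
  simp only [doubleSum_mul_left]
  rw [mul_comm, ← doubleSum_mul_left]
  simp only [mul_comm]

theorem doubleSum_doubleSum_coef (P : ℤ → ℂ) (w : ℂ) (k m l : ℕ) :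
    doubleSum (fun i => doubleSum (fun j => coef P w k i j) l) m = coef P w (k + 1) m l := by
  have ha : ∀ m, doubleSum (fun i => ((i + k).choose (2 * k) : ℂ)) m =
      ((m + (k + 1)).choose (2 * (k + 1)) : ℂ) := fun m =>
    doubleSum_choose (r := k) (p := 2 * k) (by omega) m
  have hα : ∀ m, doubleSum (fun n => ∑ i ∈ Icc (-(n : ℤ)) (n : ℤ),
      P i * ((n - i.natAbs + k).choose (2 * k) : ℂ)) m =
      ∑ i ∈ Icc (-(m : ℤ)) (m : ℤ), P i * ((m - i.natAbs + (k + 1)).choose (2 * (k + 1)) : ℂ) := by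
    intro m
    rw [doubleSum_sum_Icc P (fun n => ((n + k).choose (2 * k) : ℂ))]
    simp only [ha]
  simp only [coef, doubleSum_add, doubleSum_mul_left (-(1 / 4)), doubleSum_mul_left (w * P 0),
    doubleSum_mul_left (-w)]
  rw [doubleSum_doubleSum_mul (fun i => ((i + k).choose (2 * k) : ℂ))
      (fun i => ((i + k).choose (2 * k) : ℂ)),
    doubleSum_doubleSum_mul (fun i => (2 * i + 1) / (2 * k + 1) * ((i + k).choose (2 * k) : ℂ))
      (fun i => (2 * i + 1) / (2 * k + 1) * ((i + k).choose (2 * k) : ℂ)),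
    doubleSum_doubleSum_mul (fun n => ∑ i ∈ Icc (-(n : ℤ)) (n : ℤ),
        P i * ((n - i.natAbs + k).choose (2 * k) : ℂ))
      (fun i => (2 * i + 1) / (2 * k + 1) * ((i + k).choose (2 * k) : ℂ)),
    doubleSum_doubleSum_mul
      (fun i => (2 * i + 1) / (2 * k + 1) * ((i + k).choose (2 * k) : ℂ))
      (fun n => ∑ i ∈ Icc (-(n : ℤ)) (n : ℤ), P i * ((n - i.natAbs + k).choose (2 * k) : ℂ))]
  simp only [ha, hα, doubleSum_odd_choose]

theorem eq_sum_of_eq_add_doubleSum {q : ℕ → ℕ → ℂ} {P : ℤ → ℂ} {w X : ℂ}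
    (hq : ∀ m l, q m l = coef P w 0 m l
      + X * doubleSum (fun i => doubleSum (fun j => q i j) l) m)
    (N m l : ℕ) (hm : m < N) : q m l = ∑ k ∈ range N, X ^ k * coef P w k m l := by
  induction N generalizing m l with
  | zero => omega
  | succ N ih =>
    rw [hq, sum_range_succ', doubleSum_congr
      (g := fun i => doubleSum (fun j => ∑ k ∈ range N, X ^ k * coef P w k i j) l)
      fun i hi => doubleSum_congr fun j _ => ih i j (by omega)]
    simp only [doubleSum_sum, doubleSum_mul_left, doubleSum_doubleSum_coef, mul_sum]
    rw [pow_zero, one_mul, add_comm]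
    congr 1
    exact sum_congr rfl fun k _ => by ring

end

/-- Closed formula for `𝒬(m,l)` in terms of terminating `₄F₃` sums and diagonal values. -/
theorem Q_eq_hypergeometric (z : ℂ) (hz : ∀ x : ℝ, 0 ≤ x → x ≤ 8 → z ≠ (x : ℂ))
    (m l : ℕ) :
    Q z m l =
      -(1 / 4) * F43 (1 + m) (-m) (1 + l) (-l) 1 (1 / 2) (1 / 2) ((z - 4) ^ 2 / 16)
      + (z - 4) / 4 * (2 * m + 1) * (2 * l + 1) * P₀ z 0 *
          F43 (1 + m) (-m) (1 + l) (-l) 1 (3 / 2) (3 / 2) ((z - 4) ^ 2 / 16)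
      - (z - 4) / 4 * (2 * l + 1) *
          ∑ μ ∈ Finset.Icc (-(m : ℤ)) (m : ℤ), P₀ z μ *
            F43 (1 + m - μ.natAbs) ((μ.natAbs : ℂ) - m) (1 + l) (-l)
              1 (1 / 2) (3 / 2) ((z - 4) ^ 2 / 16)
      - (z - 4) / 4 * (2 * m + 1) *
          ∑ ν ∈ Finset.Icc (-(l : ℤ)) (l : ℤ), P₀ z ν *
            F43 (1 + m) (-m) (1 + l - ν.natAbs) ((ν.natAbs : ℂ) - l)
              1 (1 / 2) (3 / 2) ((z - 4) ^ 2 / 16) := by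
  set w : ℂ := (z - 4) / 4 with hw
  have hx : (z - 4) ^ 2 / 16 = w ^ 2 := by rw [hw]; ring
  have hQ : Q z m l = ∑ k ∈ Finset.range (m + 1), (16 * w ^ 2) ^ k * coef (P₀ z) w k m l := by
    refine eq_sum_of_eq_add_doubleSum (q := fun m l => Q z m l) (fun m l => ?_) _ m l (by omega)
    rw [eq_add_doubleSum (w := w) (Q_diff hz) (P_diff hz)
      (fun m l => by rw [Q_swap hz, Q_reflect_right hz, Q_swap hz]) (Q_reflect_right hz)
      (fun m l => by rw [P_swap hz, P_neg_right hz, P_swap hz]) (P_neg_right hz)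
      (fun l => P_swap hz 0 l)]
    simp only [coef, P_zero_right, mul_zero, add_zero, Nat.choose_zero_right, Nat.cast_one]
    push_cast
    ring_nf
  have hF : ∀ p q : ℕ, p < m + 1 → ∀ b c : ℂ, F43 (1 + p) (-p) (1 + q) (-q) 1 b c (w ^ 2) =
      ∑ k ∈ Finset.range (m + 1), ((p + k).choose (2 * k) * (q + k).choose (2 * k) : ℂ) *
        (((2 * k).factorial / (poch b k * k.factorial)) *
          ((2 * k).factorial / (poch c k * k.factorial))) * (w ^ 2) ^ k :=
    fun p q hp b c => F43_eq_sum (Or.inl hp) b c _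
  have hcast : ∀ (n : ℕ) (i : ℤ), i ∈ Finset.Icc (-(n : ℤ)) (n : ℤ) →
      (1 + n - i.natAbs : ℂ) = 1 + (n - i.natAbs : ℕ) ∧
        ((i.natAbs : ℂ) - n) = -(n - i.natAbs : ℕ) := by
    intro n i hi
    rw [Finset.mem_Icc] at hi
    rw [Nat.cast_sub (by omega)]
    constructor <;> ring
  rw [hx, hQ]
  have h3 : ∑ μ ∈ Finset.Icc (-(m : ℤ)) (m : ℤ), P₀ z μ *
      F43 (1 + m - μ.natAbs) ((μ.natAbs : ℂ) - m) (1 + l) (-l) 1 (1 / 2) (3 / 2) (w ^ 2) =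
      ∑ k ∈ Finset.range (m + 1), (16 * w ^ 2) ^ k *
        ((∑ μ ∈ Finset.Icc (-(m : ℤ)) (m : ℤ), P₀ z μ * (m - μ.natAbs + k).choose (2 * k)) *
          (1 / (2 * k + 1) * (l + k).choose (2 * k))) := by
    simp only [Finset.sum_mul, Finset.mul_sum]
    rw [Finset.sum_comm]
    refine Finset.sum_congr rfl fun μ hμ => ?_
    rw [(hcast m μ hμ).1, (hcast m μ hμ).2, hF _ _ (by omega), Finset.mul_sum]
    refine Finset.sum_congr rfl fun k _ => ?_
    rw [factorial_div_poch_half, factorial_div_poch_three_halves, mul_pow,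
      show (16 : ℂ) = 4 * 4 by norm_num, mul_pow]
    ring
  have h4 : ∑ ν ∈ Finset.Icc (-(l : ℤ)) (l : ℤ), P₀ z ν *
      F43 (1 + m) (-m) (1 + l - ν.natAbs) ((ν.natAbs : ℂ) - l) 1 (1 / 2) (3 / 2) (w ^ 2) =
      ∑ k ∈ Finset.range (m + 1), (16 * w ^ 2) ^ k *
        ((1 / (2 * k + 1) * (m + k).choose (2 * k)) *
          ∑ ν ∈ Finset.Icc (-(l : ℤ)) (l : ℤ), P₀ z ν * (l - ν.natAbs + k).choose (2 * k)) := by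
    simp only [Finset.mul_sum]
    rw [Finset.sum_comm]
    refine Finset.sum_congr rfl fun ν hν => ?_
    rw [(hcast l ν hν).1, (hcast l ν hν).2, hF _ _ (by omega), Finset.mul_sum]
    refine Finset.sum_congr rfl fun k _ => ?_
    rw [factorial_div_poch_half, factorial_div_poch_three_halves, mul_pow,
      show (16 : ℂ) = 4 * 4 by norm_num, mul_pow]
    ring
  rw [h3, h4, hF _ _ (by omega), hF _ _ (by omega)]
  rw [Finset.mul_sum, Finset.mul_sum, Finset.mul_sum, Finset.mul_sum, ← Finset.sum_add_distrib,
    ← Finset.sum_sub_distrib, ← Finset.sum_sub_distrib]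
  refine Finset.sum_congr rfl fun k _ => ?_
  rw [factorial_div_poch_half, factorial_div_poch_three_halves, mul_pow,
    show (16 : ℂ) = 4 * 4 by norm_num, mul_pow, coef]
  ring
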